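/- Let γ ∈ (-3,1]. There exist constants γ₂ > 0 and γ₃ > 0 such that for every v ∈ ℝ³ the function w ↦ |v-w|^γ μ(w) is integrable on ℝ³ and γ₂·⟨v⟩^γ ≤ ∫_{ℝ³} |v-w|^γ μ(w) dw ≤ γ₃·⟨v⟩^γ. -/

import Mathlib

open Real MeasureTheory

noncomputable abbrev jap (v : EuclideanSpace ℝ (Fin 3)) : ℝ := Real.sqrt (2 + ‖v‖ ^ 2)

/-- The standard Maxwellian `μ(v) = (2π)^{-3/2} e^{-|v|²/2}` on `ℝ³`. -/
noncomputable def Mu (v : EuclideanSpace ℝ (Fin 3)) : ℝ :=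
  (2 * Real.pi) ^ (-(3 : ℝ) / 2) * Real.exp (-‖v‖ ^ 2 / 2)

lemma rpow_le_weighted {γ a X Y : ℝ} (hγl : -3 < γ) (hγu : γ ≤ 1) (ha : 0 ≤ a) (hX : 0 < X)
    (hY : 1 ≤ Y) (haXY : a ≤ X * Y) (hXY : X ≤ Y * max a 1) :
    a ^ γ ≤ X ^ γ * Y ^ 4 * (1 + if a < 1 then a ^ γ else 0) := by
  have hY0 : 0 < Y := by linarith
  have hXγ : 0 < X ^ γ := rpow_pos_of_pos hX γ
  have haγ : 0 ≤ a ^ γ := rpow_nonneg ha γ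
  have hpow : ∀ p : ℝ, p ≤ 4 → Y ^ p ≤ Y ^ 4 := fun p hp => by
    rw [← rpow_natCast]
    exact rpow_le_rpow_of_exponent_le hY (by exact_mod_cast hp)
  have hif : (0 : ℝ) ≤ if a < 1 then a ^ γ else 0 := by split_ifs <;> positivity
  have hweight : X ^ γ * Y ^ 4 ≤ X ^ γ * Y ^ 4 * (1 + if a < 1 then a ^ γ else 0) :=
    le_mul_of_one_le_right (by positivity) (by linarith)
  rcases le_or_gt 0 γ with h0 | h0
  · refine le_trans ?_ hweight
    calc a ^ γ ≤ (X * Y) ^ γ := rpow_le_rpow ha haXY h0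
      _ = X ^ γ * Y ^ γ := mul_rpow hX.le hY0.le
      _ ≤ X ^ γ * Y ^ 4 := by gcongr; exact hpow γ (by linarith)
  · have hdiv : (X / Y) ^ γ ≤ X ^ γ * Y ^ 4 := by
      rw [div_rpow hX.le hY0.le, div_eq_mul_inv, ← rpow_neg hY0.le]
      gcongr
      exact hpow (-γ) (by linarith)
    rcases lt_or_ge a 1 with h1 | h1
    · rw [max_eq_right h1.le, mul_one] at hXY
      have hone : 1 ≤ X ^ γ * Y ^ 4 := le_trans
        (one_le_rpow_of_pos_of_le_one_of_nonpos (by positivity) ((div_le_one hY0).2 hXY) h0.le) hdiv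
      rw [if_pos h1]
      nlinarith
    · rw [max_eq_left h1] at hXY
      refine le_trans (le_trans ?_ hdiv) hweight
      exact rpow_le_rpow_of_nonpos (by positivity) ((div_le_iff₀' hY0).2 hXY) h0.le

lemma rpow_le_rpow_add_rpow {γ a b X : ℝ} (hγl : -3 < γ) (hγu : γ ≤ 1) (ha : 0 < a) (hb : 0 < b)
    (hX : 0 < X) (haX : a ≤ 2 * X) (hab : X ^ 2 ≤ a ^ 2 + b ^ 2) :
    X ^ γ / 8 ≤ a ^ γ + b ^ γ := by
  have hXγ : 0 < X ^ γ := rpow_pos_of_pos hX γ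
  have haγ : 0 < a ^ γ := rpow_pos_of_pos ha γ
  have hbγ : 0 < b ^ γ := rpow_pos_of_pos hb γ
  rcases le_or_gt 0 γ with h0 | h0
  · have hhalf : X ^ γ / 8 ≤ (X / 2) ^ γ := by
      rw [div_rpow hX.le (by norm_num)]
      have : (2 : ℝ) ^ γ ≤ 2 ^ (1 : ℝ) := rpow_le_rpow_of_exponent_le (by norm_num) hγu
      rw [rpow_one] at this
      gcongr
      linarith
    rcases le_or_gt (X / 2) a with h | h
    · linarith [rpow_le_rpow (by positivity) h h0]
    · have h' : X / 2 ≤ b := by nlinarith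
      linarith [rpow_le_rpow (by positivity) h' h0]
  · have h2 : (1 : ℝ) / 8 ≤ 2 ^ γ := by
      have : (2 : ℝ) ^ (-3 : ℝ) ≤ 2 ^ γ := rpow_le_rpow_of_exponent_le (by norm_num) hγl.le
      refine le_trans (le_of_eq ?_) this
      rw [rpow_neg (by norm_num)]
      norm_num
    have h3 := rpow_le_rpow_of_nonpos ha haX h0.le
    rw [mul_rpow (by norm_num) hX.le] at h3
    nlinarith

lemma sq_jap (v : EuclideanSpace ℝ (Fin 3)) : jap v ^ 2 = 2 + ‖v‖ ^ 2 :=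
  Real.sq_sqrt (by positivity)

lemma jap_pos (v : EuclideanSpace ℝ (Fin 3)) : 0 < jap v := Real.sqrt_pos.2 (by positivity)

lemma one_le_jap (v : EuclideanSpace ℝ (Fin 3)) : 1 ≤ jap v := by
  nlinarith [sq_jap v, jap_pos v, sq_nonneg ‖v‖]

lemma norm_le_jap (v : EuclideanSpace ℝ (Fin 3)) : ‖v‖ ≤ jap v :=
  Real.le_sqrt_of_sq_le (by linarith)

lemma jap_le_add (v : EuclideanSpace ℝ (Fin 3)) : jap v ≤ 3 / 2 + ‖v‖ := by
  nlinarith [sq_jap v, jap_pos v, norm_nonneg v]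

lemma norm_sub_le_jap_mul (v w : EuclideanSpace ℝ (Fin 3)) :
    ‖v - w‖ ≤ jap v * (3 * jap w) := by
  nlinarith [norm_sub_le v w, norm_le_jap v, norm_le_jap w, one_le_jap v, one_le_jap w]

lemma jap_le_mul_max (v w : EuclideanSpace ℝ (Fin 3)) :
    jap v ≤ 3 * jap w * max ‖v - w‖ 1 := by
  have h1 : ‖v‖ ≤ ‖v - w‖ + ‖w‖ := by simpa using norm_add_le (v - w) w
  have h2 := le_max_left ‖v - w‖ 1
  have h3 := le_max_right ‖v - w‖ 1
  have h4 : 7 / 5 ≤ jap w := by nlinarith [sq_jap w, jap_pos w, sq_nonneg ‖w‖]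
  nlinarith [jap_le_add v, norm_le_jap w]

lemma Mu_pos (w : EuclideanSpace ℝ (Fin 3)) : 0 < Mu w := by
  unfold Mu
  positivity

lemma continuous_Mu : Continuous Mu := by
  unfold Mu
  fun_prop

lemma Mu_neg (w : EuclideanSpace ℝ (Fin 3)) : Mu (-w) = Mu w := by
  simp [Mu]

lemma jap_pow_mul_Mu_le (w : EuclideanSpace ℝ (Fin 3)) :
    (3 * jap w) ^ 4 * Mu w ≤ 81 * 256 * exp (-(1 / 4) * ‖w‖ ^ 2) := by
  have hc : (2 * Real.pi) ^ (-(3 : ℝ) / 2) ≤ 1 :=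
    rpow_le_one_of_one_le_of_nonpos (by linarith [Real.pi_gt_three]) (by norm_num)
  have h1 : 2 + ‖w‖ ^ 2 ≤ 16 * exp (‖w‖ ^ 2 / 8) := by
    nlinarith [add_one_le_exp (‖w‖ ^ 2 / 8), sq_nonneg ‖w‖]
  have h2 : jap w ^ 4 ≤ 256 * exp (‖w‖ ^ 2 / 4) := by
    calc jap w ^ 4 = (jap w ^ 2) ^ 2 := by ring
      _ ≤ (16 * exp (‖w‖ ^ 2 / 8)) ^ 2 := by rw [sq_jap]; gcongr
      _ = 256 * exp (‖w‖ ^ 2 / 4) := by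
        rw [mul_pow, ← Real.exp_nat_mul]
        norm_num
        ring_nf
  calc (3 * jap w) ^ 4 * Mu w
      ≤ 81 * (256 * exp (‖w‖ ^ 2 / 4)) * (1 * exp (-‖w‖ ^ 2 / 2)) := by
        unfold Mu
        rw [mul_pow]
        refine mul_le_mul (by linarith) ?_ (by positivity) (by positivity)
        gcongr
    _ = 81 * 256 * (exp (‖w‖ ^ 2 / 4) * exp (-‖w‖ ^ 2 / 2)) := by ring
    _ = 81 * 256 * exp (-(1 / 4) * ‖w‖ ^ 2) := by
        rw [← Real.exp_add]
        ring_nf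

/-- The singular part of the kernel `|z|^γ`, cut off to the unit ball. -/
noncomputable def truncKernel (γ : ℝ) : EuclideanSpace ℝ (Fin 3) → ℝ :=
  (Metric.ball 0 1).indicator fun z => ‖z‖ ^ γ

lemma truncKernel_eq_ite (γ : ℝ) (z : EuclideanSpace ℝ (Fin 3)) :
    truncKernel γ z = if ‖z‖ < 1 then ‖z‖ ^ γ else 0 := by
  by_cases h : ‖z‖ < 1 <;> simp [truncKernel, h]

lemma truncKernel_nonneg (γ : ℝ) (z : EuclideanSpace ℝ (Fin 3)) : 0 ≤ truncKernel γ z :=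
  Set.indicator_nonneg (fun _ _ => by positivity) z

lemma integrable_truncKernel {γ : ℝ} (hγ : -3 < γ) : Integrable (truncKernel γ) := by
  refine IntegrableOn.integrable_indicator ?_ Metric.isOpen_ball.measurableSet
  refine integrableOn_ball_of_norm_le_rpow (C := 1) (α := -γ) (by simp) (by simp; linarith) ?_ ?_
  · refine ae_of_all _ fun x => ?_
    rw [neg_neg, one_mul, norm_of_nonneg (by positivity)]
  · exact (measurable_norm.pow_const γ).aestronglyMeasurable

lemma integrable_exp_neg_quarter_sq_norm :
    Integrable fun w : EuclideanSpace ℝ (Fin 3) => exp (-(1 / 4) * ‖w‖ ^ 2) := by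
  refine Integrable.of_integral_ne_zero ?_
  rw [GaussianFourier.integral_rexp_neg_mul_sq_norm (by norm_num)]
  positivity

lemma kernel_mul_Mu_le {γ : ℝ} (hγl : -3 < γ) (hγu : γ ≤ 1) (v w : EuclideanSpace ℝ (Fin 3)) :
    ‖v - w‖ ^ γ * Mu w ≤
      jap v ^ γ * (81 * 256 * (exp (-(1 / 4) * ‖w‖ ^ 2) + truncKernel γ (v - w))) := by
  have h := rpow_le_weighted hγl hγu (norm_nonneg (v - w)) (jap_pos v)
    (by linarith [one_le_jap w]) (norm_sub_le_jap_mul v w) (jap_le_mul_max v w)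
  rw [← truncKernel_eq_ite] at h
  have ht := truncKernel_nonneg γ (v - w)
  have hexp : exp (-(1 / 4) * ‖w‖ ^ 2) ≤ 1 := exp_le_one_iff.2 (by nlinarith [sq_nonneg ‖w‖])
  have hX : 0 < jap v ^ γ := rpow_pos_of_pos (jap_pos v) γ
  calc ‖v - w‖ ^ γ * Mu w
      ≤ jap v ^ γ * (3 * jap w) ^ 4 * (1 + truncKernel γ (v - w)) * Mu w :=
        mul_le_mul_of_nonneg_right h (Mu_pos w).le
    _ = jap v ^ γ * (((3 * jap w) ^ 4 * Mu w) * (1 + truncKernel γ (v - w))) := by ring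
    _ ≤ jap v ^ γ *
        ((81 * 256 * exp (-(1 / 4) * ‖w‖ ^ 2)) * (1 + truncKernel γ (v - w))) := by
        gcongr ?_ * (?_ * ?_)
        exact jap_pow_mul_Mu_le w
    _ ≤ _ := by
        refine mul_le_mul_of_nonneg_left ?_ hX.le
        nlinarith

lemma integrable_majorant {γ : ℝ} (hγl : -3 < γ) (v : EuclideanSpace ℝ (Fin 3)) :
    Integrable fun w : EuclideanSpace ℝ (Fin 3) =>
      jap v ^ γ * (81 * 256 * (exp (-(1 / 4) * ‖w‖ ^ 2) + truncKernel γ (v - w))) :=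
  ((integrable_exp_neg_quarter_sq_norm.add
    ((integrable_truncKernel hγl).comp_sub_left v)).const_mul _).const_mul _

lemma integrable_kernel_mul_Mu {γ : ℝ} (hγl : -3 < γ) (hγu : γ ≤ 1)
    (v : EuclideanSpace ℝ (Fin 3)) : Integrable fun w => ‖v - w‖ ^ γ * Mu w := by
  refine (integrable_majorant hγl v).mono' ?_ (ae_of_all _ fun w => ?_)
  · exact (((measurable_const.sub measurable_id).norm.pow_const γ).mul
      continuous_Mu.measurable).aestronglyMeasurable
  · rw [norm_of_nonneg (mul_nonneg (by positivity) (Mu_pos w).le)]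
    exact kernel_mul_Mu_le hγl hγu v w

lemma integral_kernel_mul_Mu_le {γ : ℝ} (hγl : -3 < γ) (hγu : γ ≤ 1)
    (v : EuclideanSpace ℝ (Fin 3)) :
    ∫ w, ‖v - w‖ ^ γ * Mu w ≤ (81 * 256 * ((∫ w : EuclideanSpace ℝ (Fin 3),
      exp (-(1 / 4) * ‖w‖ ^ 2)) + ∫ z, truncKernel γ z)) * jap v ^ γ := by
  refine (integral_mono (integrable_kernel_mul_Mu hγl hγu v) (integrable_majorant hγl v)
    (kernel_mul_Mu_le hγl hγu v)).trans (le_of_eq ?_)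
  rw [integral_const_mul, integral_const_mul, integral_add integrable_exp_neg_quarter_sq_norm
    ((integrable_truncKernel hγl).comp_sub_left v), integral_sub_left_eq_self (truncKernel γ),
    mul_comm]

lemma jap_rpow_le_symmetrized {γ : ℝ} (hγl : -3 < γ) (hγu : γ ≤ 1)
    {v w : EuclideanSpace ℝ (Fin 3)} (h1 : 1 ≤ ‖w‖) (h2 : ‖w‖ ≤ 2) (hne : w ≠ v) (hne' : w ≠ -v) :
    jap v ^ γ / 8 ≤ ‖v - w‖ ^ γ + ‖v + w‖ ^ γ := by
  refine rpow_le_rpow_add_rpow hγl hγu (norm_pos_iff.2 (sub_ne_zero.2 hne.symm))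
    (norm_pos_iff.2 fun h => hne' (eq_neg_of_add_eq_zero_right h)) (jap_pos v) ?_ ?_
  · refine (norm_sub_le v w).trans ?_
    nlinarith [sq_jap v, jap_pos v, norm_nonneg v, sq_nonneg (‖v‖ - 1)]
  · nlinarith [sq_jap v, parallelogram_law_with_norm ℝ v w]

lemma le_Mu_of_norm_le_two {w : EuclideanSpace ℝ (Fin 3)} (h : ‖w‖ ≤ 2) :
    (2 * Real.pi) ^ (-(3 : ℝ) / 2) * exp (-2) ≤ Mu w := by
  unfold Mu
  gcongr
  nlinarith [norm_nonneg w]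

lemma le_integral_kernel_mul_Mu {γ : ℝ} (hγl : -3 < γ) (hγu : γ ≤ 1)
    {x : EuclideanSpace ℝ (Fin 3)} (hx : ‖x‖ = 3 / 2) (v : EuclideanSpace ℝ (Fin 3)) :
    ((2 * Real.pi) ^ (-(3 : ℝ) / 2) * exp (-2) * volume.real (Metric.ball x (1 / 2)) / 16) *
      jap v ^ γ ≤ ∫ w, ‖v - w‖ ^ γ * Mu w := by
  have hF := integrable_kernel_mul_Mu hγl hγu v
  have hF' : Integrable fun w => ‖v + w‖ ^ γ * Mu w := by
    simpa [Mu_neg] using hF.comp_neg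
  have hint : ∫ w, ‖v + w‖ ^ γ * Mu w = ∫ w, ‖v - w‖ ^ γ * Mu w := by
    rw [← integral_neg_eq_self]
    simp [Mu_neg, ← sub_eq_add_neg]
  set m := (2 * Real.pi) ^ (-(3 : ℝ) / 2) * exp (-2)
  have hm : 0 < m := by positivity
  have hX : 0 < jap v ^ γ := rpow_pos_of_pos (jap_pos v) γ
  have hball : ∫ _ in Metric.ball x (1 / 2), jap v ^ γ / 8 * m ≤
      ∫ w in Metric.ball x (1 / 2), (‖v - w‖ ^ γ * Mu w + ‖v + w‖ ^ γ * Mu w) := by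
    refine setIntegral_mono_on_ae (integrableOn_const measure_ball_lt_top.ne)
      (hF.add hF').integrableOn measurableSet_ball ?_
    filter_upwards [volume.ae_ne v, volume.ae_ne (-v)] with w hv hv' hw
    rw [Metric.mem_ball, dist_eq_norm] at hw
    have h1 : ‖x‖ ≤ ‖w - x‖ + ‖w‖ := by
      rw [norm_sub_rev]
      simpa using norm_add_le (x - w) w
    have h2 : ‖w‖ ≤ ‖w - x‖ + ‖x‖ := by simpa using norm_add_le (w - x) x
    have hw2 : ‖w‖ ≤ 2 := by linarith
    rw [← add_mul]
    exact mul_le_mul (jap_rpow_le_symmetrized hγl hγu (by linarith) hw2 hv hv')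
      (le_Mu_of_norm_le_two hw2) hm.le (by positivity)
  have hle : ∫ w in Metric.ball x (1 / 2), (‖v - w‖ ^ γ * Mu w + ‖v + w‖ ^ γ * Mu w) ≤
      ∫ w, (‖v - w‖ ^ γ * Mu w + ‖v + w‖ ^ γ * Mu w) :=
    setIntegral_le_integral (hF.add hF') (ae_of_all _ fun w =>
      add_nonneg (mul_nonneg (by positivity) (Mu_pos w).le)
        (mul_nonneg (by positivity) (Mu_pos w).le))
  rw [integral_add hF hF', hint] at hle
  rw [setIntegral_const, smul_eq_mul] at hball
  linarith

/-- For `γ ∈ (-3,1]` there are constants `γ₂, γ₃ > 0` with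
`γ₂ ⟨v⟩^γ ≤ ∫ |v-w|^γ μ(w) dw ≤ γ₃ ⟨v⟩^γ`. -/
theorem maxwellian_convolution_bounds (γ : ℝ) (hγl : -3 < γ) (hγu : γ ≤ 1) :
    ∃ γ₂ > (0 : ℝ), ∃ γ₃ > (0 : ℝ), ∀ v : EuclideanSpace ℝ (Fin 3),
      Integrable (fun w => ‖v - w‖ ^ γ * Mu w) ∧
      γ₂ * jap v ^ γ ≤ (∫ w, ‖v - w‖ ^ γ * Mu w) ∧
      (∫ w, ‖v - w‖ ^ γ * Mu w) ≤ γ₃ * jap v ^ γ := by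
  obtain ⟨x, hx⟩ := exists_norm_eq (EuclideanSpace ℝ (Fin 3)) (c := 3 / 2) (by norm_num)
  have hvol : 0 < volume.real (Metric.ball x (1 / 2)) :=
    ENNReal.toReal_pos (Metric.measure_ball_pos _ _ (by norm_num)).ne' measure_ball_lt_top.ne
  have hexp : 0 < ∫ w : EuclideanSpace ℝ (Fin 3), exp (-(1 / 4) * ‖w‖ ^ 2) := by
    rw [GaussianFourier.integral_rexp_neg_mul_sq_norm (by norm_num)]
    positivity
  have htrunc : 0 ≤ ∫ z, truncKernel γ z := integral_nonneg (truncKernel_nonneg γ)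
  exact ⟨_, by positivity, _, by positivity, fun v => ⟨integrable_kernel_mul_Mu hγl hγu v,
    le_integral_kernel_mul_Mu hγl hγu hx v, integral_kernel_mul_Mu_le hγl hγu v⟩⟩
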